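/- Let (m,n) ∈ ℕ₀² with m ≥ n, m ≢ n (mod 2), and (m,n) ≠ (1,0). Then the set ∂Q(λ_{m,n}) ∩ E contains at least two elements, where λ_{m,n} = m² + n². Specifically, (m−1,n) always belongs to it; if n ≥ 1 then (m,n−1) also belongs, and if n = 0 then (m−1,2) also belongs. -/

import Mathlib

theorem stmt8 (m n : ℕ) (hmn : n ≤ m) (hpar : m % 2 ≠ n % 2) (hne : (m, n) ≠ (1, 0))
    (S : Set (ℕ × ℕ))
    (hS : S = {p : ℕ × ℕ | p.2 ≤ p.1 ∧ p.1 ^ 2 + p.2 ^ 2 < m ^ 2 + n ^ 2 ∧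
        (m ^ 2 + n ^ 2 ≤ (p.1 + 1) ^ 2 + p.2 ^ 2 ∨ p.1 + 1 < p.2) ∧
        p.1 % 2 = p.2 % 2}) :
    (m - 1, n) ∈ S ∧
    (1 ≤ n → (m, n - 1) ∈ S) ∧
    (n = 0 → (m - 1, 2) ∈ S) ∧
    2 ≤ S.ncard := by
  obtain ⟨k, rfl⟩ : ∃ k, m = k + 1 := ⟨m - 1, by omega⟩
  have h1 : (k + 1 - 1, n) ∈ S := by
    rw [hS]
    refine ⟨?_, ?_, Or.inl ?_, ?_⟩ <;> simp only [Nat.add_sub_cancel]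
    · omega
    · nlinarith
    · exact le_refl _
    · omega
  have h2 : 1 ≤ n → (k + 1, n - 1) ∈ S := by
    intro hn
    obtain ⟨j, rfl⟩ : ∃ j, n = j + 1 := ⟨n - 1, by omega⟩
    rw [hS]
    refine ⟨?_, ?_, Or.inl ?_, ?_⟩ <;> simp only [Nat.add_sub_cancel]
    · omega
    · nlinarith
    · nlinarith
    · omega
  have h3 : n = 0 → (k + 1 - 1, 2) ∈ S := by
    intro hn
    subst hn
    have hk : k ≠ 0 := by
      rintro rfl
      exact hne rfl
    have hk2 : 2 ≤ k := by omega
    rw [hS]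
    refine ⟨?_, ?_, Or.inl ?_, ?_⟩ <;> simp only [Nat.add_sub_cancel]
    · omega
    · nlinarith
    · nlinarith
    · omega
  refine ⟨h1, h2, h3, ?_⟩
  have hfin : S.Finite := by
    refine (Set.finite_Iic (((k + 1) ^ 2 + n ^ 2, (k + 1) ^ 2 + n ^ 2) : ℕ × ℕ)).subset ?_
    rintro ⟨p, q⟩ hp
    rw [hS] at hp
    obtain ⟨-, hlt, -⟩ := hp
    simp only at hlt
    have hp2 : p ≤ p ^ 2 := Nat.le_self_pow two_ne_zero p
    have hq2 : q ≤ q ^ 2 := Nat.le_self_pow two_ne_zero q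
    exact Prod.mk_le_mk.2 ⟨by omega, by omega⟩
  have key : 1 < S.ncard := by
    rw [Set.one_lt_ncard_iff hfin]
    rcases Nat.eq_zero_or_pos n with hn | hn
    · exact ⟨_, _, h1, h3 hn, by simp [hn]⟩
    · exact ⟨_, _, h1, h2 hn, by simp⟩
  exact key
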